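/- arXiv:2404.10695 — 2 statements merged into one kernel-verified Lean document; each statement's English description precedes it below -/
import Mathlib

section
/- The image of f₀ under the Fricke involution is a holomorphic quantum modular function of weight zero for Γ₁(3): setting f₀*(y) := f₀(−1/(3y)) for y in the upper half-plane ℍ, one has (i) f₀*(y/(3y+1)) = f₀*(y) for every y ∈ ℍ (the cocycle of the generator γ₃ = [[1,0],[3,1]] is trivial), and (ii) there exists a function h : ℂ → ℂ that is complex-differentiable on ℂ ∖ ℝ_{≤0} and satisfies h(y) = f₀*(y+1) − f₀*(y) for every y ∈ ℍ (the cocycle of the generator T = [[1,1],[0,1]] extends holomorphically to the cut plane). -/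
open scoped Real

noncomputable section

/-- The nonprincipal Dirichlet character modulo 3. -/
def chi (n : ℤ) : ℤ := if n % 3 = 1 then 1 else if n % 3 = 2 then -1 else 0

/-- The weak-coupling Stokes constants of local ℙ². -/
def S (n : ℕ) : ℂ := 3 * Real.sqrt 3 * Complex.I * ∑ d ∈ n.divisors, (chi d : ℂ) / d

/-- The strong-coupling Stokes constants of local ℙ². -/
def R (n : ℕ) : ℂ := 3 * ∑ d ∈ n.divisors, (chi d : ℂ) * d / n

/-- The generating function of the weak-coupling Stokes constants on the upper half-plane. -/
def f0 (y : ℂ) : ℂ := ∑' n : ℕ, S (n + 1) * Complex.exp (2 * π * Complex.I * (n + 1) * y)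

/-- The generating function of the strong-coupling Stokes constants on the upper half-plane. -/
def finf (y : ℂ) : ℂ := ∑' n : ℕ, R (n + 1) * Complex.exp (2 * π * Complex.I * (n + 1) * y)

/-- The summand of the double series `∑ 1 / (n (3m + 1 + 3ny) (3m + 2 + 3ny))`. -/
def psiTerm (p : ℕ × ℕ) (y : ℂ) : ℂ :=
  1 / ((p.1 + 1) * ((3 * p.2 + 1 + 3 * (p.1 + 1) * y) * (3 * p.2 + 2 + 3 * (p.1 + 1) * y)))

/-- The double series `∑ 1 / (n (3m + 1 + 3ny) (3m + 2 + 3ny))`, holomorphic on the slit plane. -/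
def psiSeries (y : ℂ) : ℂ := ∑' p : ℕ × ℕ, psiTerm p y

/-- The sum `∑ e^{2πikw}` over `k ≥ 1`. -/
def geomExp (w : ℂ) : ℂ := ∑' n : ℕ, Complex.exp (2 * π * Complex.I * w) ^ (n + 1)

lemma exists_ball_norm_add_mul_ge {y₀ : ℂ} (hy₀ : y₀ ∈ Complex.slitPlane) :
    ∃ r > 0, Metric.ball y₀ r ⊆ Complex.slitPlane ∧ ∃ c : ℝ, 0 < c ∧
      ∀ y ∈ Metric.ball y₀ r, ∀ a b : ℝ, 0 ≤ a → 0 ≤ b → c * (a + b) ≤ ‖(a : ℂ) + b * y‖ := by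
  obtain ⟨r, hr, hsub⟩ := Metric.nhds_basis_closedBall.mem_iff.mp
    (Complex.isOpen_slitPlane.mem_nhds hy₀)
  have hK : IsCompact (Set.Icc (0 : ℝ) 1 ×ˢ Metric.closedBall y₀ r) :=
    isCompact_Icc.prod (isCompact_closedBall _ _)
  obtain ⟨⟨t₀, y₁⟩, hmem, hmin⟩ := hK.exists_isMinOn
    ⟨(0, y₀), by simp, by simp [hr.le]⟩
    (f := fun q : ℝ × ℂ ↦ ‖(1 : ℂ) + (q.1 : ℂ) • (q.2 - 1)‖) (by fun_prop)
  have hpos : 0 < ‖(1 : ℂ) + (t₀ : ℂ) • (y₁ - 1)‖ := by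
    rw [norm_pos_iff]
    refine Complex.slitPlane_ne_zero ?_
    have := Complex.starConvex_one_slitPlane.add_smul_sub_mem (hsub hmem.2) hmem.1.1 hmem.1.2
    simpa using this
  refine ⟨r, hr, Metric.ball_subset_closedBall.trans hsub, _, hpos, fun y hy a b ha hb ↦ ?_⟩
  rcases (add_nonneg ha hb).eq_or_lt with h0 | h0
  · rw [← h0]; simp
  · have h := hmin (a := (b / (a + b), y)) ⟨⟨by positivity, by rw [div_le_one h0]; linarith⟩,
      Metric.ball_subset_closedBall hy⟩
    have key : (a : ℂ) + b * y = ((a + b : ℝ) : ℂ) *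
        (1 + ((b / (a + b) : ℝ) : ℂ) • (y - 1)) := by
      have : (a : ℂ) + b ≠ 0 := by exact_mod_cast h0.ne'
      push_cast
      rw [smul_eq_mul]
      field_simp
      ring
    rw [key, norm_mul, Complex.norm_real, Real.norm_of_nonneg h0.le, mul_comm]
    exact mul_le_mul_of_nonneg_left h h0.le

lemma summable_prod_rpow_succ :
    Summable fun p : ℕ × ℕ ↦ ((p.1 + 1 : ℝ) ^ (3 / 2 : ℝ))⁻¹ * ((p.2 + 1 : ℝ) ^ (3 / 2 : ℝ))⁻¹ := by
  have h : Summable fun n : ℕ ↦ ((n + 1 : ℝ) ^ (3 / 2 : ℝ))⁻¹ := by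
    have := (summable_nat_add_iff 1).mpr
      (Real.summable_nat_rpow_inv.mpr (show (1 : ℝ) < 3 / 2 by norm_num))
    simpa using this
  exact h.mul_of_nonneg h (fun _ ↦ by positivity) (fun _ ↦ by positivity)

lemma norm_psiTerm_le {y : ℂ} {c : ℝ} (hc : 0 < c)
    (h : ∀ a b : ℝ, 0 ≤ a → 0 ≤ b → c * (a + b) ≤ ‖(a : ℂ) + b * y‖) (p : ℕ × ℕ) :
    ‖psiTerm p y‖ ≤
      (c ^ 2)⁻¹ * (((p.1 + 1 : ℝ) ^ (3 / 2 : ℝ))⁻¹ * ((p.2 + 1 : ℝ) ^ (3 / 2 : ℝ))⁻¹) := by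
  obtain ⟨n, m⟩ := p
  simp only [psiTerm]
  have hn : (0 : ℝ) < n + 1 := by positivity
  have hm : (0 : ℝ) < m + 1 := by positivity
  have h1 := h (3 * m + 1) (3 * (n + 1)) (by positivity) (by positivity)
  have h2 := h (3 * m + 2) (3 * (n + 1)) (by positivity) (by positivity)
  push_cast at h1 h2
  have hs : (0 : ℝ) < (n + 1) + (m + 1) := by positivity
  have h1' : c * ((n + 1) + (m + 1)) ≤ ‖(3 * m + 1 + 3 * (n + 1) * y : ℂ)‖ :=
    le_trans (mul_le_mul_of_nonneg_left (by linarith [(Nat.cast_nonneg n : (0 : ℝ) ≤ n),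
      (Nat.cast_nonneg m : (0 : ℝ) ≤ m)]) hc.le) h1
  have h2' : c * ((n + 1) + (m + 1)) ≤ ‖(3 * m + 2 + 3 * (n + 1) * y : ℂ)‖ :=
    le_trans (mul_le_mul_of_nonneg_left (by linarith [(Nat.cast_nonneg n : (0 : ℝ) ≤ n),
      (Nat.cast_nonneg m : (0 : ℝ) ≤ m)]) hc.le) h2
  have hsq : ((n + 1 : ℝ) ^ (1 / 2 : ℝ)) * ((m + 1 : ℝ) ^ (3 / 2 : ℝ)) ≤
      ((n + 1 : ℝ) + (m + 1)) ^ 2 := by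
    calc _ ≤ ((n + 1 : ℝ) + (m + 1)) ^ (1 / 2 : ℝ) * ((n + 1 : ℝ) + (m + 1)) ^ (3 / 2 : ℝ) := by
          exact mul_le_mul (Real.rpow_le_rpow hn.le (by linarith) (by norm_num))
            (Real.rpow_le_rpow hm.le (by linarith) (by norm_num)) (by positivity) (by positivity)
      _ = _ := by
          rw [← Real.rpow_add hs, ← Real.rpow_natCast]
          norm_num
  have hsplit : (n + 1 : ℝ) ^ (3 / 2 : ℝ) = (n + 1) * (n + 1 : ℝ) ^ (1 / 2 : ℝ) := by
    rw [← Real.rpow_one_add' hn.le (by norm_num)]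
    norm_num
  have hnn : ‖(n + 1 : ℂ)‖ = n + 1 := by
    rw [show (n + 1 : ℂ) = ((n + 1 : ℝ) : ℂ) by push_cast; rfl, Complex.norm_real,
      Real.norm_of_nonneg hn.le]
  rw [norm_div, norm_one, norm_mul, norm_mul, hnn, ← mul_inv, ← mul_inv, one_div]
  apply inv_anti₀ (by positivity)
  calc c ^ 2 * ((n + 1 : ℝ) ^ (3 / 2 : ℝ) * (m + 1 : ℝ) ^ (3 / 2 : ℝ))
      = (n + 1) * (c ^ 2 * ((n + 1 : ℝ) ^ (1 / 2 : ℝ) * (m + 1 : ℝ) ^ (3 / 2 : ℝ))) := by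
        rw [hsplit]; ring
    _ ≤ (n + 1) * (c ^ 2 * ((n + 1 : ℝ) + (m + 1)) ^ 2) := by gcongr
    _ = (n + 1) * ((c * ((n + 1) + (m + 1))) * (c * ((n + 1) + (m + 1)))) := by ring
    _ ≤ _ := by gcongr

lemma summable_psiTerm {y : ℂ} (hy : y ∈ Complex.slitPlane) :
    Summable fun p ↦ psiTerm p y := by
  obtain ⟨r, hr, -, c, hc, h⟩ := exists_ball_norm_add_mul_ge hy
  exact .of_norm_bounded (summable_prod_rpow_succ.mul_left _)
    (norm_psiTerm_le hc (h y (Metric.mem_ball_self hr)))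

lemma ofReal_add_mul_ne_zero {y : ℂ} (hy : y ∈ Complex.slitPlane) {a b : ℝ} (ha : 0 < a)
    (hb : 0 ≤ b) : (a : ℂ) + b * y ≠ 0 := by
  obtain ⟨r, hr, -, c, hc, h⟩ := exists_ball_norm_add_mul_ge hy
  exact norm_pos_iff.mp (lt_of_lt_of_le (by positivity)
    (h y (Metric.mem_ball_self hr) a b ha.le hb))

lemma differentiableOn_psiSeries : DifferentiableOn ℂ psiSeries Complex.slitPlane := by
  intro y hy
  obtain ⟨r, hr, hsub, c, hc, h⟩ := exists_ball_norm_add_mul_ge hy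
  refine ((Complex.differentiableOn_tsum_of_summable_norm (F := psiTerm)
    (summable_prod_rpow_succ.mul_left (c ^ 2)⁻¹) (fun p z hz ↦ ?_) Metric.isOpen_ball
    (fun p z hz ↦ norm_psiTerm_le hc (h z hz) p)).differentiableAt
      (Metric.ball_mem_nhds y hr)).differentiableWithinAt
  have h1 := ofReal_add_mul_ne_zero (hsub hz) (a := 3 * p.2 + 1) (b := 3 * (p.1 + 1))
    (by positivity) (by positivity)
  have h2 := ofReal_add_mul_ne_zero (hsub hz) (a := 3 * p.2 + 2) (b := 3 * (p.1 + 1))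
    (by positivity) (by positivity)
  push_cast at h1 h2
  have h3 : (p.1 + 1 : ℂ) ≠ 0 := Nat.cast_add_one_ne_zero p.1
  have : DifferentiableAt ℂ (psiTerm p) z := by
    unfold psiTerm
    exact (differentiableAt_const _).div (by fun_prop) (mul_ne_zero h3 (mul_ne_zero h1 h2))
  exact this.differentiableWithinAt

lemma slitPlane_of_im_ne_zero {y : ℂ} (hy : y.im ≠ 0) : y ∈ Complex.slitPlane := Or.inr hy

lemma tsum_psiTerm_add_neg {y : ℂ} (hy : y.im ≠ 0) (n : ℕ) :
    (∑' m, psiTerm (n, m) y) + ∑' m, psiTerm (n, m) (-y) =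
      ∑' m : ℤ, 1 / ((n + 1) * ((3 * m + 1 + 3 * (n + 1) * y) * (3 * m + 2 + 3 * (n + 1) * y))) := by
  have h1 := (summable_psiTerm (slitPlane_of_im_ne_zero hy)).prod_factor n
  have h2 := (summable_psiTerm (y := -y) (slitPlane_of_im_ne_zero (by simpa using hy))).prod_factor n
  rw [tsum_of_nat_of_neg_add_one]
  · congr 1
    refine tsum_congr fun m ↦ ?_
    simp only [psiTerm]
    push_cast
    ring_nf
  · simpa [psiTerm] using h1
  · refine h2.congr fun m ↦ ?_
    simp only [psiTerm]
    push_cast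
    ring_nf

lemma psiSeries_add_neg_add_one {y : ℂ} (hy : y.im ≠ 0) :
    psiSeries (y + 1) + psiSeries (-(y + 1)) = psiSeries y + psiSeries (-y) := by
  have key : ∀ {y : ℂ}, y.im ≠ 0 → psiSeries y + psiSeries (-y) =
      ∑' n : ℕ, ∑' m : ℤ,
        1 / ((n + 1) * ((3 * m + 1 + 3 * (n + 1) * y) * (3 * m + 2 + 3 * (n + 1) * y))) := by
    intro y hy
    have h1 := summable_psiTerm (slitPlane_of_im_ne_zero hy)
    have h2 := summable_psiTerm (y := -y) (slitPlane_of_im_ne_zero (by simpa using hy))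
    rw [psiSeries, psiSeries, h1.tsum_prod, h2.tsum_prod, ← h1.prod.tsum_add h2.prod]
    exact tsum_congr fun n ↦ tsum_psiTerm_add_neg hy n
  rw [key hy, key (by simpa using hy)]
  refine tsum_congr fun n ↦ ?_
  rw [← (Equiv.addRight (n + 1 : ℤ)).tsum_eq fun m : ℤ ↦
    1 / ((n + 1) * ((3 * m + 1 + 3 * (n + 1) * y) * (3 * m + 2 + 3 * (n + 1) * y)))]
  refine tsum_congr fun m ↦ ?_
  simp only [Equiv.coe_addRight]
  push_cast
  ring_nf

lemma geomExp_eq {w : ℂ} (hw : 0 < w.im) :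
    geomExp w = -1 / 2 - 1 / (2 * π * Complex.I) *
      (1 / w + ∑' n : ℕ, (1 / (w - (n + 1)) + 1 / (w + (n + 1)))) := by
  have h1 := pi_mul_cot_pi_q_exp ⟨w, hw⟩
  have h2 := cot_series_rep' (UpperHalfPlane.coe_mem_integerComplement ⟨w, hw⟩)
  have hq : ‖Complex.exp (2 * π * Complex.I * w)‖ < 1 :=
    UpperHalfPlane.norm_exp_two_pi_I_lt_one ⟨w, hw⟩
  simp only at h1 h2
  rw [← h2, h1, (summable_geometric_of_norm_lt_one hq).tsum_eq_zero_add, geomExp]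
  have : (π : ℂ) ≠ 0 := by exact_mod_cast Real.pi_ne_zero
  have := Complex.I_ne_zero
  field_simp
  ring

lemma im_neg_one_div_mul_pos {y : ℂ} (hy : 0 < y.im) {d : ℝ} (hd : 0 < d) :
    0 < ((d : ℂ) * (-1 / (3 * y))).im := by
  have hy0 : y ≠ 0 := by rintro rfl; simp at hy
  have : 0 < Complex.normSq y := Complex.normSq_pos.mpr hy0
  have h : (d : ℂ) * (-1 / (3 * y)) = ((d / 3 : ℝ) : ℂ) * (-y⁻¹) := by
    push_cast; field_simp
  rw [h, Complex.im_ofReal_mul, Complex.neg_im, Complex.inv_im]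
  have : 0 < y.im / Complex.normSq y := by positivity
  rw [neg_div, neg_neg]
  positivity

lemma geomExp_fricke {y : ℂ} (hy : 0 < y.im) {d : ℝ} (hd : 0 < d) :
    HasSum (fun n : ℕ ↦ 1 / (n + 1 : ℂ) * (1 / (d + 3 * (n + 1) * y) - 1 / (d - 3 * (n + 1) * y)))
      (-(2 * π * Complex.I) * (geomExp (d * (-1 / (3 * y))) / d + 1 / (2 * d)) + 3 * y / d ^ 2) := by
  have hw := im_neg_one_div_mul_pos hy hd
  have hy0 : y ≠ 0 := by rintro rfl; simp at hy
  have hd0 : (d : ℂ) ≠ 0 := by exact_mod_cast hd.ne'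
  have hpi : (π : ℂ) ≠ 0 := by exact_mod_cast Real.pi_ne_zero
  have hI := Complex.I_ne_zero
  have hs : HasSum (fun n : ℕ ↦ 1 / (d : ℂ) * (1 / (d * (-1 / (3 * y)) - (n + 1)) +
      1 / (d * (-1 / (3 * y)) + (n + 1)))) _ :=
    (summable_cotTerm (UpperHalfPlane.coe_mem_integerComplement ⟨_, hw⟩)).hasSum.mul_left
      (1 / (d : ℂ))
  convert hs.congr_fun (fun n ↦ ?_) using 1
  · rw [geomExp_eq hw]
    simp only [cotTerm]
    generalize ∑' n : ℕ, (1 / ((d : ℂ) * (-1 / (3 * y)) - (n + 1)) +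
      1 / (d * (-1 / (3 * y)) + (n + 1))) = s
    field_simp
    ring
  · have hn : (n + 1 : ℂ) ≠ 0 := Nat.cast_add_one_ne_zero n
    have h1 := ofReal_add_mul_ne_zero (slitPlane_of_im_ne_zero hy.ne') hd
      (b := 3 * (n + 1)) (by positivity)
    have h2 := ofReal_add_mul_ne_zero (y := -y) (slitPlane_of_im_ne_zero (by simpa using hy.ne'))
      hd (b := 3 * (n + 1)) (by positivity)
    push_cast at h1 h2
    have e1 : (d : ℂ) * (-1 / (3 * y)) - (n + 1) = -(d + 3 * (n + 1) * y) / (3 * y) := by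
      field_simp; ring
    have e2 : (d : ℂ) * (-1 / (3 * y)) + (n + 1) = -(d - 3 * (n + 1) * y) / (3 * y) := by
      field_simp; ring
    have h3 : (d : ℂ) - 3 * (n + 1) * y ≠ 0 := by simpa [sub_eq_add_neg] using h2
    rw [e1, e2]
    have hw0 : 3 * (n + 1 : ℂ) * y ≠ 0 := by simp [hn, hy0]
    have hyw : 3 * y = 3 * (n + 1 : ℂ) * y / (n + 1) := by field_simp
    rw [hyw]
    generalize 3 * (n + 1 : ℂ) * y = w at *
    field_simp
    ring

lemma summable_lambert {a : ℕ → ℂ} (ha : ∀ d, ‖a d‖ ≤ 1) {q : ℂ} (hq : ‖q‖ < 1) :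
    Summable fun p : ℕ+ × ℕ+ ↦ a p.1 * q ^ (p.1 * p.2 : ℕ) := by
  refine (summable_prod_mul_pow 0 (r := ‖q‖) (by simpa using hq)).of_norm_bounded fun p ↦ ?_
  rw [norm_mul, norm_pow, pow_zero]
  gcongr
  exact ha _

lemma tsum_sum_divisors_mul_pow {a : ℕ → ℂ} (ha : ∀ d, ‖a d‖ ≤ 1) {q : ℂ} (hq : ‖q‖ < 1) :
    ∑' n : ℕ+, (∑ d ∈ (n : ℕ).divisors, a d) * q ^ (n : ℕ) =
      ∑' d : ℕ+, a d * ∑' k : ℕ+, q ^ (d * k : ℕ) := by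
  have hs := summable_lambert ha hq
  simp_rw [← tsum_mul_left]
  rw [← hs.tsum_prod, ← sigmaAntidiagonalEquivProd.tsum_eq,
    Summable.tsum_sigma (by exact sigmaAntidiagonalEquivProd.summable_iff.mpr hs)]
  refine tsum_congr fun n ↦ ?_
  simp only [sigmaAntidiagonalEquivProd, divisorsAntidiagonalFactors, PNat.mk_coe,
    Equiv.coe_fn_mk, tsum_fintype, Finset.univ_eq_attach]
  rw [(n : ℕ).divisorsAntidiagonal.sum_attach fun x : ℕ × ℕ ↦ a x.1 * q ^ (x.1 * x.2),
    Nat.sum_divisorsAntidiagonal fun x y ↦ a x * q ^ (x * y), Finset.sum_mul]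
  exact Finset.sum_congr rfl fun i hi ↦ by rw [Nat.mul_div_cancel' (Nat.dvd_of_mem_divisors hi)]

lemma norm_chi_div_le (d : ℕ) : ‖(chi d : ℂ) / d‖ ≤ 1 := by
  rcases Nat.eq_zero_or_pos d with rfl | hd
  · simp
  · have h1 : ‖(chi d : ℂ)‖ ≤ 1 := by
      unfold chi
      split_ifs <;> simp
    have h2 : (1 : ℝ) ≤ d := by exact_mod_cast hd
    rw [norm_div, Complex.norm_natCast]
    exact div_le_one_of_le₀ (h1.trans h2) (by positivity)

lemma hasSum_f0 {z : ℂ} (hz : 0 < z.im) :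
    ∃ A, f0 z = 3 * Real.sqrt 3 * Complex.I * A ∧
      HasSum (fun m : ℕ ↦ geomExp ((3 * m + 1) * z) / (3 * m + 1) -
        geomExp ((3 * m + 2) * z) / (3 * m + 2)) A := by
  set q := Complex.exp (2 * π * Complex.I * z) with hqdef
  have hq : ‖q‖ < 1 := UpperHalfPlane.norm_exp_two_pi_I_lt_one ⟨z, hz⟩
  have hgeom (d : ℕ) : ∑' k : ℕ+, q ^ (d * k : ℕ) = geomExp (d * z) := by
    rw [tsum_pnat_eq_tsum_succ (f := fun k ↦ q ^ (d * k)), geomExp]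
    refine tsum_congr fun k ↦ ?_
    rw [hqdef, ← Complex.exp_nat_mul, ← Complex.exp_nat_mul]
    push_cast
    ring_nf
  have hs : Summable fun d : ℕ+ ↦ (chi (d : ℕ) : ℂ) / (d : ℕ) * geomExp ((d : ℕ) * z) := by
    have := (summable_lambert norm_chi_div_le hq).prod
    refine this.congr fun d ↦ ?_
    simp only [tsum_mul_left, hgeom]
  have hs' : Summable fun d : ℕ ↦ (chi d : ℂ) / d * geomExp (d * z) := by
    rw [← summable_nat_add_iff 1]
    exact summable_pnat_iff_summable_succ (f := fun d : ℕ ↦ (chi d : ℂ) / d * geomExp (d * z)) |>.mp hs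
  have chi1 (m : ℕ) : chi (3 * m + 1 : ℤ) = 1 := by unfold chi; rw [if_pos (by lia)]
  have chi2 (m : ℕ) : chi (3 * m + 2 : ℤ) = -1 := by
    unfold chi; rw [if_neg (by lia), if_pos (by lia)]
  have chi0 (m : ℕ) : chi (3 * m : ℤ) = 0 := by
    unfold chi; rw [if_neg (by lia), if_neg (by lia)]
  have hs1 : Summable fun m : ℕ ↦ geomExp ((3 * m + 1) * z) / (3 * m + 1) := by
    refine (hs'.comp_injective (i := fun m ↦ 3 * m + 1) fun a b h ↦ by simpa using h).congr
      fun m ↦ ?_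
    simp [chi1]
    ring
  have hs2 : Summable fun m : ℕ ↦ geomExp ((3 * m + 2) * z) / (3 * m + 2) := by
    refine (hs'.comp_injective (i := fun m ↦ 3 * m + 2) fun a b h ↦ by simpa using h).neg.congr
      fun m ↦ ?_
    simp [chi2]
    ring
  refine ⟨_, ?_, (hs1.sub hs2).hasSum⟩
  have e1 : f0 z = 3 * Real.sqrt 3 * Complex.I *
      ∑' n : ℕ+, (∑ d ∈ (n : ℕ).divisors, (chi d : ℂ) / d) * q ^ (n : ℕ) := by
    rw [tsum_pnat_eq_tsum_succ
      (f := fun n ↦ (∑ d ∈ n.divisors, (chi d : ℂ) / d) * q ^ n), ← tsum_mul_left, f0]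
    refine tsum_congr fun n ↦ ?_
    rw [S, hqdef, ← Complex.exp_nat_mul, mul_assoc]
    push_cast
    ring_nf
  rw [e1, tsum_sum_divisors_mul_pow norm_chi_div_le hq]
  simp_rw [hgeom]
  congr 1
  have e2 := tsum_zero_pnat_eq_tsum_nat hs'
  simp only [Nat.cast_zero, div_zero, zero_mul, zero_add] at e2
  rw [e2, Nat.sumByResidueClasses hs' 3, hs1.tsum_sub hs2, sub_eq_add_neg, ← tsum_neg]
  have e3 (F : ZMod 3 → ℂ) : ∑ j, F j = F 0 + F 1 + F 2 := Fin.sum_univ_three F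
  rw [e3]
  have v0 : (0 : ZMod 3).val = 0 := rfl
  have v1 : (1 : ZMod 3).val = 1 := rfl
  have v2 : (2 : ZMod 3).val = 2 := rfl
  rw [v0, v1, v2]
  have t0 : ∑' m : ℕ, (chi (0 + 3 * m : ℕ) : ℂ) / (0 + 3 * m : ℕ) *
      geomExp ((0 + 3 * m : ℕ) * z) = 0 := by
    simp [chi0]
  rw [t0, zero_add]
  congr 1 <;> refine tsum_congr fun m ↦ ?_
  · rw [add_comm 1]
    simp [chi1]
    ring
  · rw [add_comm 2]
    simp [chi2]
    ring

lemma summable_inv_three_mul_add_sq {a : ℝ} (ha : 1 ≤ a) :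
    Summable fun m : ℕ ↦ 1 / (3 * m + a : ℂ) ^ 2 := by
  have h : Summable fun m : ℕ ↦ 1 / (m + 1 : ℝ) ^ 2 := by
    have := (summable_nat_add_iff 1).mpr (Real.summable_one_div_nat_pow.mpr one_lt_two)
    simpa using this
  refine h.of_norm_bounded fun m ↦ ?_
  have hm : (0 : ℝ) ≤ m := m.cast_nonneg
  rw [show (3 * m + a : ℂ) = ((3 * m + a : ℝ) : ℂ) by push_cast; rfl, norm_div, norm_pow,
    Complex.norm_real, Real.norm_of_nonneg (by linarith), norm_one]
  gcongr
  linarith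

lemma f0_fricke : ∃ c κ : ℂ, ∀ y : ℂ, 0 < y.im →
    f0 (-1 / (3 * y)) = c + 3 * Real.sqrt 3 / (2 * π) *
      (3 * y * κ - (psiSeries y - psiSeries (-y))) := by
  have hκ := ((summable_inv_three_mul_add_sq le_rfl).sub
    (summable_inv_three_mul_add_sq one_le_two)).hasSum
  set κ := ∑' m : ℕ, (1 / (3 * m + (1 : ℝ) : ℂ) ^ 2 - 1 / (3 * m + (2 : ℝ) : ℂ) ^ 2)
  have hpi : (π : ℂ) ≠ 0 := by exact_mod_cast Real.pi_ne_zero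
  have hI := Complex.I_ne_zero
  have main (y : ℂ) (hy : 0 < y.im) : ∃ A, f0 (-1 / (3 * y)) = 3 * Real.sqrt 3 * Complex.I * A ∧
      HasSum (fun m : ℕ ↦ 1 / (3 * m + 1 : ℂ) - 1 / (3 * m + 2))
        (((3 * y * κ - (psiSeries y - psiSeries (-y))) / (2 * π * Complex.I) - A) * 2) := by
    have hz : 0 < (-1 / (3 * y)).im := by simpa using im_neg_one_div_mul_pos hy one_pos
    obtain ⟨A, hA, hsA⟩ := hasSum_f0 hz
    refine ⟨A, hA, ?_⟩
    have hp : HasSum (fun p ↦ psiTerm p y - psiTerm p (-y)) (psiSeries y - psiSeries (-y)) :=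
      (summable_psiTerm (slitPlane_of_im_ne_zero hy.ne')).hasSum.sub
        (summable_psiTerm (slitPlane_of_im_ne_zero (by simpa using hy.ne'))).hasSum
    have hfib (m : ℕ) := (geomExp_fricke hy (d := 3 * m + 1) (by positivity)).sub
      (geomExp_fricke hy (d := 3 * m + 2) (by positivity))
    have hsum := HasSum.prod_fiberwise ((Equiv.prodComm ℕ ℕ).hasSum_iff.mpr hp) fun m ↦ by
      refine (hfib m).congr_fun fun n ↦ ?_
      have h1 := ofReal_add_mul_ne_zero (slitPlane_of_im_ne_zero hy.ne')
        (a := 3 * m + 1) (b := 3 * (n + 1)) (by positivity) (by positivity)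
      have h2 := ofReal_add_mul_ne_zero (slitPlane_of_im_ne_zero hy.ne')
        (a := 3 * m + 2) (b := 3 * (n + 1)) (by positivity) (by positivity)
      have h3 := ofReal_add_mul_ne_zero (y := -y) (slitPlane_of_im_ne_zero (by simpa using hy.ne'))
        (a := 3 * m + 1) (b := 3 * (n + 1)) (by positivity) (by positivity)
      have h4 := ofReal_add_mul_ne_zero (y := -y) (slitPlane_of_im_ne_zero (by simpa using hy.ne'))
        (a := 3 * m + 2) (b := 3 * (n + 1)) (by positivity) (by positivity)
      push_cast [mul_neg, ← sub_eq_add_neg] at h1 h2 h3 h4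
      have hn : (n + 1 : ℂ) ≠ 0 := Nat.cast_add_one_ne_zero n
      simp only [Function.comp_apply, Equiv.prodComm_apply, Prod.swap_prod_mk, psiTerm, mul_neg,
        ← sub_eq_add_neg]
      push_cast
      generalize 3 * (n + 1 : ℂ) * y = w at *
      field_simp
      ring
    have hfin := (((hκ.mul_left (3 * y)).sub hsum).div_const (2 * π * Complex.I)).sub hsA
    refine (hfin.mul_right 2).congr_fun fun m ↦ ?_
    have h1 : (3 * m + 1 : ℂ) ≠ 0 := by exact_mod_cast (3 * m).succ_ne_zero
    have h2 : (3 * m + 2 : ℂ) ≠ 0 := by exact_mod_cast (3 * m + 1).succ_ne_zero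
    push_cast
    generalize geomExp _ = u
    generalize geomExp _ = v
    field_simp
    ring
  refine ⟨-(3 * Real.sqrt 3 * Complex.I *
    ((∑' m : ℕ, (1 / (3 * m + 1 : ℂ) - 1 / (3 * m + 2))) / 2)), κ, fun y hy ↦ ?_⟩
  obtain ⟨A, hA, hs⟩ := main y hy
  rw [hA, hs.tsum_eq]
  field_simp
  ring

lemma f0_add_intCast (z : ℂ) (k : ℤ) : f0 (z + k) = f0 z := by
  refine tsum_congr fun n ↦ ?_
  congr 1
  rw [Complex.exp_eq_exp_iff_exists_int]
  exact ⟨(n + 1) * k, by push_cast; ring⟩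

/-- The Fricke image `f₀*(y) = f₀(−1/(3y))` is a holomorphic quantum modular function of
weight zero for `Γ₁(3)`: the cocycle of `γ₃ = [[1,0],[3,1]]` is trivial, and the cocycle
of `T = [[1,1],[0,1]]` extends holomorphically to the cut plane
`ℂ ∖ ℝ_{≤0} = Complex.slitPlane`. -/
theorem stmt18 :
    (∀ y : ℂ, 0 < y.im → f0 (-1 / (3 * (y / (3 * y + 1)))) = f0 (-1 / (3 * y))) ∧
    ∃ h : ℂ → ℂ, DifferentiableOn ℂ h Complex.slitPlane ∧
      ∀ y : ℂ, 0 < y.im → h y = f0 (-1 / (3 * (y + 1))) - f0 (-1 / (3 * y)) := by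
  constructor
  · intro y hy
    have hy0 : y ≠ 0 := by rintro rfl; simp at hy
    have hy1 : 3 * y + 1 ≠ 0 := by
      intro h
      have := congrArg Complex.im h
      simp at this
      exact hy.ne' this
    rw [← f0_add_intCast (-1 / (3 * y)) (-1)]
    congr 1
    push_cast
    field_simp
    ring
  · obtain ⟨c, κ, h⟩ := f0_fricke
    refine ⟨fun y ↦ 3 * Real.sqrt 3 / (2 * π) * (3 * κ - 2 * (psiSeries (y + 1) - psiSeries y)),
      ?_, fun y hy ↦ ?_⟩
    · have h1 : DifferentiableOn ℂ (fun y ↦ psiSeries (y + 1)) Complex.slitPlane := by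
        refine differentiableOn_psiSeries.comp (by fun_prop) fun y hy ↦ ?_
        rcases hy with hy | hy
        · left
          simp
          linarith
        · right
          simpa using hy
      exact ((h1.sub differentiableOn_psiSeries).const_mul 2 |>.const_sub (3 * κ)).const_mul _
    · rw [h y hy, h (y + 1) (by simpa using hy)]
      linear_combination -(3 * Real.sqrt 3 / (2 * π) : ℂ) * (psiSeries_add_neg_add_one hy.ne')
end
end

section
/- The image of f_∞ under the Fricke involution is a holomorphic quantum modular function of weight zero for Γ₁(3): setting f_∞*(y) := f_∞(−1/(3y)) for y in the upper half-plane ℍ, one has (i) f_∞*(y/(3y+1)) = f_∞*(y) for every y ∈ ℍ (the cocycle of the generator γ₃ = [[1,0],[3,1]] is trivial), and (ii) there exists a function h : ℂ → ℂ that is complex-differentiable on ℂ ∖ ℝ_{≤0} and satisfies h(y) = f_∞*(y+1) − f_∞*(y) for every y ∈ ℍ (the cocycle of the generator T = [[1,1],[0,1]] extends holomorphically to the cut plane). -/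
open scoped Real

noncomputable section

open Filter Topology Complex

lemma norm_chi_le_one (n : ℤ) : ‖(chi n : ℂ)‖ ≤ 1 := by
  unfold chi
  split_ifs <;> simp

/-- The Lambert series attached to `chi`. -/
def lambertChi (w : ℂ) : ℂ := ∑' d : ℕ, (chi (d + 1) : ℂ) * cexp (2 * π * I * w) ^ (d + 1)

lemma norm_cexp_two_pi_lt_one {w : ℂ} (hw : 0 < w.im) : ‖cexp (2 * π * I * w)‖ < 1 := by
  simpa using UpperHalfPlane.norm_exp_two_pi_I_lt_one ⟨w, hw⟩

lemma R_mul_pow_eq_sum (q : ℂ) (n : ℕ+) : R n * q ^ (n : ℕ) =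
    ∑ x ∈ (n : ℕ).divisorsAntidiagonal, 3 * (chi x.2 : ℂ) / x.1 * q ^ (x.1 * x.2) := by
  rw [Nat.sum_divisorsAntidiagonal' fun a b : ℕ ↦ 3 * (chi b : ℂ) / a * q ^ (a * b), R,
    mul_assoc, Finset.sum_mul, Finset.mul_sum]
  refine Finset.sum_congr rfl fun d hd ↦ ?_
  have hdn := Nat.dvd_of_mem_divisors hd
  have hd0 : (d : ℂ) ≠ 0 := by exact_mod_cast (Nat.pos_of_mem_divisors hd).ne'
  have hn0 : ((n : ℕ) : ℂ) ≠ 0 := by exact_mod_cast n.ne_zero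
  rw [Nat.div_mul_cancel hdn, Nat.cast_div hdn hd0]
  field_simp

lemma summable_chi_div_mul_pow {q : ℂ} (hq : ‖q‖ < 1) :
    Summable fun p : ℕ+ × ℕ+ ↦
      3 * (chi (p.2 : ℕ) : ℂ) / (p.1 : ℕ) * q ^ ((p.1 : ℕ) * (p.2 : ℕ)) := by
  refine Summable.of_norm_bounded ((summable_prod_mul_pow 0 hq).norm.mul_left 3) fun p ↦ ?_
  have h1 : (1 : ℝ) ≤ (p.1 : ℕ) := by exact_mod_cast p.1.pos
  have h2 := norm_chi_le_one (p.2 : ℕ)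
  rw [norm_mul, norm_div, norm_mul]
  simp only [pow_zero, one_mul, Complex.norm_ofNat, Complex.norm_natCast]
  gcongr
  rw [div_le_iff₀ (by linarith)]
  nlinarith

lemma finf_eq_tsum_lambertChi {w : ℂ} (hw : 0 < w.im) :
    finf w = ∑' m : ℕ, 3 / ((m : ℂ) + 1) * lambertChi ((m + 1) * w) := by
  set q := cexp (2 * π * I * w) with hq_def
  have hq : ‖q‖ < 1 := norm_cexp_two_pi_lt_one hw
  have hs := summable_chi_div_mul_pow hq
  have h1 : finf w = ∑' n : ℕ+, R n * q ^ (n : ℕ) := by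
    rw [tsum_pnat_eq_tsum_succ (f := fun n : ℕ ↦ R n * q ^ n), finf]
    refine tsum_congr fun n ↦ ?_
    rw [hq_def, ← Complex.exp_nat_mul]
    congr 2
    push_cast
    ring
  have h2 : ∑' n : ℕ+, R n * q ^ (n : ℕ) = ∑' p : ℕ+ × ℕ+,
      3 * (chi (p.2 : ℕ) : ℂ) / (p.1 : ℕ) * q ^ ((p.1 : ℕ) * (p.2 : ℕ)) := by
    rw [← sigmaAntidiagonalEquivProd.tsum_eq]
    refine Eq.trans ?_ (sigmaAntidiagonalEquivProd.summable_iff.mpr hs).tsum_sigma.symm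
    refine tsum_congr fun n ↦ ?_
    rw [R_mul_pow_eq_sum, tsum_fintype, Finset.univ_eq_attach]
    exact ((n : ℕ).divisorsAntidiagonal.sum_attach
      fun x ↦ 3 * (chi x.2 : ℂ) / x.1 * q ^ (x.1 * x.2)).symm
  rw [h1, h2, hs.tsum_prod, tsum_pnat_eq_tsum_succ
    (f := fun a : ℕ ↦ ∑' b : ℕ+, 3 * (chi (b : ℕ) : ℂ) / a * q ^ (a * (b : ℕ)))]
  refine tsum_congr fun m ↦ ?_
  rw [tsum_pnat_eq_tsum_succ
    (f := fun b : ℕ ↦ 3 * (chi b : ℂ) / (m + 1 : ℕ) * q ^ ((m + 1) * b)), lambertChi,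
    ← tsum_mul_left]
  refine tsum_congr fun d ↦ ?_
  rw [pow_mul, hq_def, ← Complex.exp_nat_mul]
  push_cast
  rw [show (m + 1 : ℂ) * (2 * π * I * w) = 2 * π * I * ((m + 1) * w) by ring]
  ring

lemma cexp_two_pi_div_three : cexp (2 * π * I * (1 / 3)) = -1 / 2 + (√3 : ℝ) / 2 * I := by
  rw [show (2 * π * I * (1 / 3) : ℂ) = ((2 * π / 3 : ℝ) : ℂ) * I by push_cast; ring,
    Complex.exp_mul_I, ← Complex.ofReal_cos, ← Complex.ofReal_sin,
    show (2 * π / 3 : ℝ) = π - π / 3 by ring, Real.cos_pi_sub, Real.sin_pi_sub,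
    Real.cos_pi_div_three, Real.sin_pi_div_three]
  push_cast
  ring

lemma conj_pow_sub_pow_eq_chi {a : ℂ} (h1 : a ^ 2 = -1 - a) (n : ℕ) :
    (-1 - a) ^ n - a ^ n = chi n * (-1 - 2 * a) := by
  have h3 : a ^ 3 = 1 := by linear_combination (a - 1) * h1
  have h3' : (-1 - a) ^ 3 = 1 := by linear_combination -(a + 2) * h1
  obtain ⟨k, r, hr, rfl⟩ : ∃ k r : ℕ, r < 3 ∧ n = 3 * k + r :=
    ⟨n / 3, n % 3, Nat.mod_lt _ (by norm_num), (Nat.div_add_mod n 3).symm⟩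
  rw [pow_add, pow_add, pow_mul, pow_mul, h3, h3']
  have hmod : ((3 * k + r : ℕ) : ℤ) % 3 = r := by push_cast; omega
  unfold chi
  rw [hmod]
  interval_cases r
  · simp
  · simp; ring
  · norm_num; ring

lemma lambertChi_eq_cot {w : ℂ} (hw : 0 < w.im) :
    lambertChi w = -(1 / (2 * (√3 : ℝ) * π)) *
      (π * cot (π * (w - 1 / 3)) - π * cot (π * (w + 1 / 3))) := by
  set q := cexp (2 * π * I * w) with hq_def
  have hq : ‖q‖ < 1 := norm_cexp_two_pi_lt_one hw
  set a := cexp (2 * π * I * (1 / 3)) with ha_def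
  have ha := cexp_two_pi_div_three
  have hs3 : ((√3 : ℝ) : ℂ) ^ 2 = 3 := by
    rw [← Complex.ofReal_pow, Real.sq_sqrt (by norm_num)]; norm_num
  have hs0 : ((√3 : ℝ) : ℂ) ≠ 0 := by
    intro h; rw [h] at hs3; norm_num at hs3
  have ha2 : a ^ 2 = -1 - a := by
    rw [ha_def, ha]
    linear_combination (I ^ 2 / 4) * hs3 + (3 / 4) * Complex.I_sq
  have hainv : cexp (2 * π * I * (w - 1 / 3)) = (-1 - a) * q := by
    have h3 : a * (-1 - a) = 1 := by linear_combination -ha2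
    have : a ≠ 0 := by rintro h; rw [h] at h3; norm_num at h3
    rw [mul_sub, Complex.exp_sub, ← hq_def, ← ha_def, div_eq_iff this]
    linear_combination -q * h3
  have hapos : cexp (2 * π * I * (w + 1 / 3)) = a * q := by
    rw [mul_add, Complex.exp_add]; ring
  have him1 : 0 < (w - 1 / 3).im := by
    rw [Complex.sub_im, show (1 / 3 : ℂ) = ((1 / 3 : ℝ) : ℂ) by norm_num, Complex.ofReal_im]
    simpa using hw
  have him2 : 0 < (w + 1 / 3).im := by
    rw [Complex.add_im, show (1 / 3 : ℂ) = ((1 / 3 : ℝ) : ℂ) by norm_num, Complex.ofReal_im]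
    simpa using hw
  have c1 := pi_mul_cot_pi_q_exp ⟨w - 1 / 3, him1⟩
  have c2 := pi_mul_cot_pi_q_exp ⟨w + 1 / 3, him2⟩
  simp only at c1 c2
  have n1 := norm_cexp_two_pi_lt_one him1
  have n2 := norm_cexp_two_pi_lt_one him2
  rw [hainv] at c1 n1
  rw [hapos] at c2 n2
  have s1 := summable_geometric_of_norm_lt_one n1
  have s2 := summable_geometric_of_norm_lt_one n2
  have key : ∑' n : ℕ, ((-1 - a) * q) ^ n - ∑' n : ℕ, (a * q) ^ n
      = (-1 - 2 * a) * lambertChi w := by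
    rw [← s1.tsum_sub s2, (s1.sub s2).tsum_eq_zero_add, lambertChi, ← tsum_mul_left]
    simp only [pow_zero, sub_self, zero_add]
    refine tsum_congr fun n ↦ ?_
    rw [mul_pow, mul_pow, ← sub_mul, conj_pow_sub_pow_eq_chi ha2]
    push_cast
    ring
  rw [c1, c2, show (π * I - 2 * π * I * ∑' n : ℕ, ((-1 - a) * q) ^ n -
    (π * I - 2 * π * I * ∑' n : ℕ, (a * q) ^ n) : ℂ) = -(2 * π * I) *
      (∑' n : ℕ, ((-1 - a) * q) ^ n - ∑' n : ℕ, (a * q) ^ n) by ring, key, ha_def, ha]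
  have hpi : (π : ℂ) ≠ 0 := by exact_mod_cast Real.pi_ne_zero
  field_simp
  linear_combination ((√3 : ℝ) * lambertChi w) * Complex.I_sq

/-- The `n`-th partial fraction in the expansion of the `m`-th term of `finf (-1 / (3 * y))`. -/
def cotFraction (y : ℂ) (m n : ℕ) : ℂ :=
  1 / n * (1 / (m + 1) - (1 / (m + 1 - n * y) + 1 / (m + 1 + n * y)) / 2)

/-- The terms `n = 3 j + 4` and `n = 3 j + 2` grouped, to get absolute convergence. -/
def cotFractionPair (y : ℂ) (m j : ℕ) : ℂ :=
  cotFraction y m (3 * j + 4) - cotFraction y m (3 * j + 2)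

lemma add_mul_ne_zero_of_im_ne_zero {y : ℂ} (hy : y.im ≠ 0) (m : ℕ) {n : ℕ} (hn : n ≠ 0) :
    (m + 1 + n * y : ℂ) ≠ 0 := by
  intro h
  have := congrArg Complex.im h
  simp [hn, hy] at this

lemma sub_mul_ne_zero_of_im_ne_zero {y : ℂ} (hy : y.im ≠ 0) (m : ℕ) {n : ℕ} (hn : n ≠ 0) :
    (m + 1 - n * y : ℂ) ≠ 0 := by
  have := add_mul_ne_zero_of_im_ne_zero (y := -y) (by simpa using hy) m hn
  rwa [mul_neg, ← sub_eq_add_neg] at this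

lemma cotFraction_eq {y : ℂ} (hy : y.im ≠ 0) (m : ℕ) {n : ℕ} (hn : n ≠ 0) :
    cotFraction y m n =
      y / (2 * (m + 1)) * (1 / (m + 1 + n * y) - 1 / (m + 1 - n * y)) := by
  have h1 := add_mul_ne_zero_of_im_ne_zero hy m hn
  have h2 := sub_mul_ne_zero_of_im_ne_zero hy m hn
  have h3 : (n : ℂ) ≠ 0 := by exact_mod_cast hn
  have h4 : (m + 1 : ℂ) ≠ 0 := by exact_mod_cast m.succ_ne_zero
  unfold cotFraction
  field_simp
  ring

lemma hasSum_cot_sub_cot {w : ℂ} (hw : 0 < w.im) :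
    HasSum (fun j : ℕ ↦ (1 / (w - 1 / 3 - (j + 1)) + 1 / (w - 1 / 3 + (j + 1))) -
        (1 / (w + 1 / 3 - (j + 1)) + 1 / (w + 1 / 3 + (j + 1))))
      ((π * cot (π * (w - 1 / 3)) - 1 / (w - 1 / 3)) -
        (π * cot (π * (w + 1 / 3)) - 1 / (w + 1 / 3))) := by
  have key : ∀ x : ℂ, x.im ≠ 0 →
      HasSum (fun j : ℕ ↦ 1 / (x - (j + 1)) + 1 / (x + (j + 1))) (π * cot (π * x) - 1 / x) := by
    intro x hx
    have hx' : x ∈ integerComplement := by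
      rintro ⟨k, rfl⟩
      simp at hx
    rw [cot_series_rep' hx']
    exact (summable_cotTerm hx').hasSum
  refine (key _ ?_).sub (key _ ?_)
  · rw [show (1 / 3 : ℂ) = ((1 / 3 : ℝ) : ℂ) by norm_num, Complex.sub_im, Complex.ofReal_im]
    simpa using hw.ne'
  · rw [show (1 / 3 : ℂ) = ((1 / 3 : ℝ) : ℂ) by norm_num, Complex.add_im, Complex.ofReal_im]
    simpa using hw.ne'

lemma im_neg_one_div_pos {y : ℂ} (hy : 0 < y.im) : 0 < (-1 / (3 * y)).im := by
  have h0 : y ≠ 0 := by rintro rfl; simp at hy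
  rw [show -1 / (3 * y) = ((1 / 3 : ℝ) : ℂ) * (-y⁻¹) by push_cast; field_simp,
    Complex.im_ofReal_mul, Complex.neg_im, Complex.inv_im]
  have := Complex.normSq_pos.mpr h0
  rw [neg_div, neg_neg]
  positivity

lemma lambertChi_eq_tsum_cotFraction {y : ℂ} (hy : 0 < y.im) (m : ℕ) :
    3 / ((m : ℂ) + 1) * lambertChi ((m + 1) * (-1 / (3 * y))) =
      3 * (√3 : ℝ) / π * (cotFraction y m 1 + ∑' j, cotFractionPair y m j) := by
  set w : ℂ := (m + 1) * (-1 / (3 * y)) with hw_def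
  have hw : 0 < w.im := by
    rw [hw_def, show (m + 1 : ℂ) = ((m + 1 : ℝ) : ℂ) by push_cast; rfl, Complex.im_ofReal_mul]
    have := im_neg_one_div_pos hy
    positivity
  have h0 : y ≠ 0 := by rintro rfl; simp at hy
  have hM : (m + 1 : ℂ) ≠ 0 := by exact_mod_cast m.succ_ne_zero
  have hs := hasSum_cot_sub_cot hw
  have frac : ∀ n : ℕ, n ≠ 0 →
      1 / (w - n / 3) - 1 / (w + n / 3) = -6 * (m + 1) * cotFraction y m n := by
    intro n hn
    have h1 := add_mul_ne_zero_of_im_ne_zero hy.ne' m hn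
    have h2 := sub_mul_ne_zero_of_im_ne_zero hy.ne' m hn
    rw [cotFraction_eq hy.ne' m hn,
      show w - n / 3 = -(m + 1 + n * y) / (3 * y) by rw [hw_def]; field_simp; ring,
      show w + n / 3 = -(m + 1 - n * y) / (3 * y) by rw [hw_def]; field_simp; ring]
    field_simp
    ring
  have hs' : ∑' j, -6 * (m + 1 : ℂ) * cotFractionPair y m j =
      (π * cot (π * (w - 1 / 3)) - 1 / (w - 1 / 3)) -
        (π * cot (π * (w + 1 / 3)) - 1 / (w + 1 / 3)) := by
    rw [← hs.tsum_eq]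
    refine tsum_congr fun j ↦ ?_
    have e1 := frac (3 * j + 4) (by omega)
    have e2 := frac (3 * j + 2) (by omega)
    rw [cotFractionPair, mul_sub, ← e1, ← e2]
    push_cast
    rw [show w - 1 / 3 - (j + 1) = w - (3 * j + 4) / 3 by ring,
      show w - 1 / 3 + (j + 1) = w + (3 * j + 2) / 3 by ring,
      show w + 1 / 3 - (j + 1) = w - (3 * j + 2) / 3 by ring,
      show w + 1 / 3 + (j + 1) = w + (3 * j + 4) / 3 by ring]
    ring
  rw [tsum_mul_left] at hs'
  have e0 := frac 1 one_ne_zero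
  push_cast at e0
  have hpi : (π : ℂ) ≠ 0 := by exact_mod_cast Real.pi_ne_zero
  have hs3 : ((√3 : ℝ) : ℂ) ^ 2 = 3 := by
    rw [← Complex.ofReal_pow, Real.sq_sqrt (by norm_num)]; norm_num
  have hs0 : ((√3 : ℝ) : ℂ) ≠ 0 := by
    intro h; rw [h] at hs3; norm_num at hs3
  rw [lambertChi_eq_cot hw, show π * cot (π * (w - 1 / 3)) - π * cot (π * (w + 1 / 3)) =
    -6 * (m + 1) * (cotFraction y m 1 + ∑' j, cotFractionPair y m j) by
      linear_combination e0 - hs']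
  field_simp
  rw [hs3]
  ring

lemma exists_mul_le_norm_add {y₀ : ℂ} (h : y₀ ∈ slitPlane) :
    ∃ c > 0, ∀ y ∈ Metric.ball y₀ c, ∀ s : ℝ, 0 ≤ s → c * (1 + s) ≤ ‖y + s‖ := by
  obtain ⟨c, hc, H⟩ : ∃ c > 0, ∀ s : ℝ, 0 ≤ s → c * (1 + s) ≤ ‖y₀ + s‖ := by
    rcases h with h | h
    · refine ⟨min y₀.re 1, by positivity, fun s hs ↦ ?_⟩
      have h1 : y₀.re + s ≤ ‖y₀ + s‖ := by simpa using Complex.re_le_norm (y₀ + s)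
      nlinarith [min_le_left y₀.re 1, min_le_right y₀.re 1]
    · have him : 0 < |y₀.im| := abs_pos.mpr h
      refine ⟨|y₀.im| / (|y₀.im| + 1 + ‖y₀‖), by positivity, fun s hs ↦ ?_⟩
      have h1 : |y₀.im| ≤ ‖y₀ + s‖ := by simpa using Complex.abs_im_le_norm (y₀ + s)
      have h2 : s ≤ ‖y₀ + s‖ + ‖y₀‖ := by
        have := norm_sub_le (y₀ + s) y₀
        simpa [abs_of_nonneg hs] using this
      rw [div_mul_eq_mul_div, div_le_iff₀ (by positivity)]
      nlinarith [norm_nonneg y₀]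
  refine ⟨c / 2, by positivity, fun y hy s hs ↦ ?_⟩
  have h1 : ‖y₀ + s‖ ≤ ‖y + s‖ + ‖y - y₀‖ := by
    have := norm_sub_le (y + s) (y - y₀)
    rwa [show y + s - (y - y₀) = y₀ + s by ring] at this
  rw [Metric.mem_ball, dist_eq_norm] at hy
  nlinarith [H s hs]

lemma exists_mul_le_norm_add_mul {y : ℂ} (hy : y.im ≠ 0) :
    ∃ c > 0, ∀ m n : ℕ, n ≠ 0 → c * (n + (m + 1)) ≤ ‖(m + 1 + n * y : ℂ)‖ ∧
      c * (n + (m + 1)) ≤ ‖(m + 1 - n * y : ℂ)‖ := by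
  have key : ∀ z : ℂ, z.im ≠ 0 → ∃ c > 0, ∀ m n : ℕ, n ≠ 0 →
      c * (n + (m + 1)) ≤ ‖(m + 1 + n * z : ℂ)‖ := by
    intro z hz
    obtain ⟨c, hc, H⟩ := exists_mul_le_norm_add (y₀ := z) (Or.inr hz)
    refine ⟨c, hc, fun m n hn ↦ ?_⟩
    have hn0 : (0 : ℝ) < n := by exact_mod_cast Nat.pos_of_ne_zero hn
    have hn1 : (n : ℂ) ≠ 0 := by exact_mod_cast hn
    have h1 := H z (Metric.mem_ball_self hc) ((m + 1) / n) (by positivity)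
    have h2 : (m + 1 + n * z : ℂ) = n * (z + ((m + 1) / n : ℝ)) := by
      push_cast
      field_simp
      ring
    rw [h2, norm_mul, Complex.norm_natCast]
    calc c * (n + (m + 1)) = n * (c * (1 + (m + 1) / n)) := by field_simp
      _ ≤ _ := by gcongr
  obtain ⟨c₁, h1, H1⟩ := key y hy
  obtain ⟨c₂, h2, H2⟩ := key (-y) (by simpa using hy)
  refine ⟨min c₁ c₂, lt_min h1 h2, fun m n hn ↦ ⟨?_, ?_⟩⟩
  · exact (mul_le_mul_of_nonneg_right (min_le_left _ _) (by positivity)).trans (H1 m n hn)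
  · have := (mul_le_mul_of_nonneg_right (min_le_right c₁ c₂)
      (by positivity : (0 : ℝ) ≤ n + (m + 1))).trans (H2 m n hn)
    rwa [mul_neg, ← sub_eq_add_neg] at this

lemma summable_cotFraction {y : ℂ} (hy : y.im ≠ 0) {n : ℕ} (hn : n ≠ 0) :
    Summable fun m ↦ cotFraction y m n := by
  obtain ⟨c, hc, H⟩ := exists_mul_le_norm_add_mul hy
  have hs : Summable fun m : ℕ ↦ ‖y‖ ^ 2 * n / c ^ 2 * (1 / ((m + 1 : ℕ) : ℝ) ^ 2) :=
    ((summable_nat_add_iff 1).mpr (Real.summable_one_div_nat_pow.mpr one_lt_two)).mul_left _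
  refine Summable.of_norm_bounded hs fun m ↦ ?_
  obtain ⟨h1, h2⟩ := H m n hn
  have e1 := add_mul_ne_zero_of_im_ne_zero hy m hn
  have e2 := sub_mul_ne_zero_of_im_ne_zero hy m hn
  have hM : (m + 1 : ℂ) ≠ 0 := by exact_mod_cast m.succ_ne_zero
  have hnn : (0 : ℝ) ≤ n := by positivity
  have hMn : ‖(m + 1 : ℂ)‖ = m + 1 := by exact_mod_cast Complex.norm_natCast (m + 1)
  have h1' : c * (m + 1) ≤ ‖(m + 1 + n * y : ℂ)‖ := by nlinarith
  have h2' : c * (m + 1) ≤ ‖(m + 1 - n * y : ℂ)‖ := by nlinarith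
  have : cotFraction y m n = -(y ^ 2 * n) / ((m + 1) * ((m + 1 + n * y) * (m + 1 - n * y))) := by
    rw [cotFraction_eq hy m hn, div_sub_div _ _ e1 e2, div_mul_div_comm,
      div_eq_div_iff
      (mul_ne_zero (mul_ne_zero two_ne_zero hM) (mul_ne_zero e1 e2))
      (mul_ne_zero hM (mul_ne_zero e1 e2))]
    ring
  rw [this, norm_div, norm_neg, norm_mul, norm_pow, norm_mul, norm_mul, hMn, Complex.norm_natCast]
  calc _ ≤ ‖y‖ ^ 2 * n / (1 * ((c * (m + 1)) * (c * (m + 1)))) := by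
        gcongr
        linarith [(Nat.cast_nonneg m : (0 : ℝ) ≤ m)]
    _ = _ := by push_cast; field_simp

lemma one_div_mul_add_sq_le {a b : ℝ} (ha : 0 < a) (hb : 0 < b) :
    1 / (a * (b + a) ^ 2) ≤ 1 / a ^ (3 / 2 : ℝ) * (1 / b ^ (3 / 2 : ℝ)) := by
  rw [← one_div_mul_one_div_rev, mul_comm, one_div_mul_one_div_rev, one_div_mul_one_div_rev]
  refine one_div_le_one_div_of_le (by positivity) ?_
  have h1 : a ^ (1 / 2 : ℝ) ≤ (b + a) ^ (1 / 2 : ℝ) := by gcongr; linarith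
  have h2 : b ^ (3 / 2 : ℝ) ≤ (b + a) ^ (3 / 2 : ℝ) := by gcongr; linarith
  have h3 : a ^ (3 / 2 : ℝ) = a * a ^ (1 / 2 : ℝ) := by
    rw [← Real.rpow_one_add' ha.le (by norm_num)]; norm_num
  have h4 : (b + a) ^ 2 = (b + a) ^ (1 / 2 : ℝ) * (b + a) ^ (3 / 2 : ℝ) := by
    rw [← Real.rpow_add (by positivity), ← Real.rpow_natCast]; norm_num
  rw [h3, h4]
  calc _ = a * (a ^ (1 / 2 : ℝ) * b ^ (3 / 2 : ℝ)) := by ring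
    _ ≤ a * ((b + a) ^ (1 / 2 : ℝ) * (b + a) ^ (3 / 2 : ℝ)) := by gcongr
    _ = _ := by ring

lemma summable_cotFractionPair {y : ℂ} (hy : y.im ≠ 0) :
    Summable fun p : ℕ × ℕ ↦ cotFractionPair y p.1 p.2 := by
  obtain ⟨c, hc, H⟩ := exists_mul_le_norm_add_mul hy
  have hs1 : Summable fun m : ℕ ↦ 1 / (((m + 1 : ℕ) : ℝ) ^ (3 / 2 : ℝ)) :=
    (summable_nat_add_iff 1).mpr (Real.summable_one_div_nat_rpow.mpr (by norm_num))
  have hs2 := (hs1.mul_of_nonneg hs1 (fun _ ↦ by positivity) (fun _ ↦ by positivity)).mul_left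
    (2 * ‖y‖ ^ 2 / c ^ 2)
  refine Summable.of_norm_bounded hs2 ?_
  rintro ⟨m, j⟩
  obtain ⟨h1, h2⟩ := H m (3 * j + 4) (by omega)
  obtain ⟨h3, h4⟩ := H m (3 * j + 2) (by omega)
  have e1 := add_mul_ne_zero_of_im_ne_zero hy m (n := 3 * j + 4) (by omega)
  have e2 := sub_mul_ne_zero_of_im_ne_zero hy m (n := 3 * j + 4) (by omega)
  have e3 := add_mul_ne_zero_of_im_ne_zero hy m (n := 3 * j + 2) (by omega)
  have e4 := sub_mul_ne_zero_of_im_ne_zero hy m (n := 3 * j + 2) (by omega)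
  have hM : (m + 1 : ℂ) ≠ 0 := by exact_mod_cast m.succ_ne_zero
  have hMn : ‖(m + 1 : ℂ)‖ = m + 1 := by exact_mod_cast Complex.norm_natCast (m + 1)
  have hj : (0 : ℝ) ≤ j := by positivity
  have hm : (0 : ℝ) ≤ m := by positivity
  have key : cotFractionPair y m j = -(y ^ 2 / (m + 1)) *
      (1 / ((m + 1 + (3 * j + 4 : ℕ) * y) * (m + 1 + (3 * j + 2 : ℕ) * y)) +
        1 / ((m + 1 - (3 * j + 4 : ℕ) * y) * (m + 1 - (3 * j + 2 : ℕ) * y))) := by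
    rw [cotFractionPair, cotFraction_eq hy m (by omega), cotFraction_eq hy m (by omega)]
    have d1 : ∀ u v : ℂ, u ≠ 0 → v ≠ 0 → 1 / (u * v) * (v - u) = 1 / u - 1 / v := by
      intro u v hu hv
      field_simp
    have d2 := d1 _ _ e1 e3
    have d3 := d1 _ _ e2 e4
    rw [show y / (2 * (m + 1)) = y / (m + 1) / 2 by rw [div_div, mul_comm 2],
      show y ^ 2 / (m + 1) = y / (m + 1) * y by ring]
    push_cast at d2 d3 ⊢
    linear_combination (-(y / (m + 1) / 2)) * d2 + (y / (m + 1) / 2) * d3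
  set a : ℝ := m + 1 with ha
  set b : ℝ := j + 1 with hb
  have ha0 : 0 < a := by positivity
  have hb0 : 0 < b := by positivity
  have low : ∀ n : ℕ, b ≤ n → ∀ x : ℝ, c * (n + a) ≤ x → c * (b + a) ≤ x := by
    intro n hn x hx
    nlinarith
  have h1' := low _ (by push_cast; linarith) _ h1
  have h2' := low _ (by push_cast; linarith) _ h2
  have h3' := low _ (by push_cast; linarith) _ h3
  have h4' := low _ (by push_cast; linarith) _ h4
  rw [key, norm_mul, norm_neg, norm_div, norm_pow, hMn]
  calc _ ≤ ‖y‖ ^ 2 / a * (1 / ((c * (b + a)) * (c * (b + a))) +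
        1 / ((c * (b + a)) * (c * (b + a)))) := by
        refine mul_le_mul_of_nonneg_left ((norm_add_le _ _).trans ?_) (by positivity)
        rw [norm_div, norm_div, norm_mul, norm_mul, norm_one]
        gcongr
    _ = 2 * ‖y‖ ^ 2 / c ^ 2 * (1 / (a * (b + a) ^ 2)) := by field_simp; ring
    _ ≤ 2 * ‖y‖ ^ 2 / c ^ 2 * (1 / a ^ (3 / 2 : ℝ) * (1 / b ^ (3 / 2 : ℝ))) := by
        gcongr
        exact one_div_mul_add_sq_le ha0 hb0
    _ = _ := by rw [ha, hb]; push_cast; rfl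

/-- The sum over `m` of the partial fractions `cotFraction y m n`. -/
def cotFractionSum (y : ℂ) (n : ℕ) : ℂ := ∑' m, cotFraction y m n

lemma tsum_cotFractionPair {y : ℂ} (hy : y.im ≠ 0) (j : ℕ) :
    ∑' m, cotFractionPair y m j =
      cotFractionSum y (3 * j + 4) - cotFractionSum y (3 * j + 2) :=
  (summable_cotFraction hy (by omega)).tsum_sub (summable_cotFraction hy (by omega))

lemma summable_cotFractionSum {y : ℂ} (hy : y.im ≠ 0) :
    Summable fun j : ℕ ↦ cotFractionSum y (3 * j + 4) - cotFractionSum y (3 * j + 2) := by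
  simp_rw [← tsum_cotFractionPair hy]
  have h : Summable fun p : ℕ × ℕ ↦ cotFractionPair y p.2 p.1 :=
    (summable_cotFractionPair hy).prod_symm
  exact h.prod

lemma finf_fricke_eq {y : ℂ} (hy : 0 < y.im) :
    finf (-1 / (3 * y)) = 3 * (√3 : ℝ) / π * (cotFractionSum y 1 +
      ∑' j : ℕ, (cotFractionSum y (3 * j + 4) - cotFractionSum y (3 * j + 2))) := by
  have hs := summable_cotFractionPair hy.ne'
  have hcomm : ∑' m, ∑' j, cotFractionPair y m j = ∑' j, ∑' m, cotFractionPair y m j :=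
    Summable.tsum_comm hs.prod_symm
  have hadd := (summable_cotFraction hy.ne' one_ne_zero).tsum_add hs.prod
  rw [finf_eq_tsum_lambertChi (im_neg_one_div_pos hy)]
  simp_rw [lambertChi_eq_tsum_cotFraction hy, ← tsum_cotFractionPair hy.ne']
  rw [tsum_mul_left, hadd, hcomm, cotFractionSum]

lemma tsum_sub_shift {s : ℕ → ℂ} {n : ℕ} (hs : Tendsto s atTop (𝓝 0))
    (hsum : Summable fun m ↦ s m - s (m + n)) :
    ∑' m, (s m - s (m + n)) = ∑ m ∈ Finset.range n, s m := by
  refine tendsto_nhds_unique hsum.hasSum.tendsto_sum_nat ?_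
  have h1 : ∀ N, ∑ m ∈ Finset.range N, (s m - s (m + n)) =
      ∑ m ∈ Finset.range n, s m - ∑ i ∈ Finset.range n, s (N + i) := by
    intro N
    have e1 := Finset.sum_range_add s N n
    have e2 := Finset.sum_range_add s n N
    rw [add_comm n N] at e2
    simp_rw [add_comm n] at e2
    rw [Finset.sum_sub_distrib]
    linear_combination e2 - e1
  simp_rw [h1]
  have h2 : Tendsto (fun N ↦ ∑ i ∈ Finset.range n, s (N + i)) atTop (𝓝 0) := by
    simpa using tendsto_finsetSum (Finset.range n)
      fun i _ ↦ hs.comp (tendsto_add_atTop_nat i)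
  simpa using h2.const_sub (∑ m ∈ Finset.range n, s m)

/-- The trapezoidal sum with `n` steps for `∫ t in 0..1, 1 / (y + t)`. -/
def trapezoidInv (y : ℂ) (n : ℕ) : ℂ :=
  ∑ k ∈ Finset.range n, (1 / (n * y + k) + 1 / (n * y + (k + 1))) / 2

lemma tendsto_one_div_natCast_add (z : ℂ) : Tendsto (fun m : ℕ ↦ 1 / (m + z)) atTop (𝓝 0) := by
  simp_rw [one_div]
  refine tendsto_inv₀_cobounded.comp ?_
  exact (tendsto_add_const_cobounded z).comp tendsto_natCast_atTop_cobounded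

lemma cotFractionSum_add_one_sub {y : ℂ} (hy : 0 < y.im) {n : ℕ} (hn : n ≠ 0) :
    cotFractionSum (y + 1) n - cotFractionSum y n = 1 / n * trapezoidInv y n := by
  have hy1 : (y + 1).im ≠ 0 := by simpa using hy.ne'
  have hn0 : (n : ℂ) ≠ 0 := by exact_mod_cast hn
  set s : ℕ → ℂ := fun m ↦ 1 / (m + (1 + n * y)) - 1 / (m + (1 - n - n * y)) with hs_def
  have hs : Tendsto s atTop (𝓝 0) := by
    have := (tendsto_one_div_natCast_add (1 + n * y)).sub
      (tendsto_one_div_natCast_add (1 - n - n * y))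
    rwa [sub_zero] at this
  have term : ∀ m, s m - s (m + n) = 2 * n * (cotFraction (y + 1) m n - cotFraction y m n) := by
    intro m
    simp only [hs_def, cotFraction]
    push_cast
    rw [show (m + n + (1 + n * y) : ℂ) = m + 1 + n * (y + 1) by ring,
      show (m + n + (1 - n - n * y) : ℂ) = m + 1 - n * y by ring,
      show (m + (1 - n - n * y) : ℂ) = m + 1 - n * (y + 1) by ring,
      show (m + (1 + n * y) : ℂ) = m + 1 + n * y by ring]
    field_simp
    ring
  have hsum := ((summable_cotFraction hy1 hn).sub (summable_cotFraction hy.ne' hn)).mul_left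
    (2 * n : ℂ)
  have key := tsum_sub_shift hs (hsum.congr fun m ↦ (term m).symm)
  simp_rw [term] at key
  rw [tsum_mul_left, (summable_cotFraction hy1 hn).tsum_sub (summable_cotFraction hy.ne' hn)] at key
  change 2 * n * (cotFractionSum (y + 1) n - cotFractionSum y n) = _ at key
  have hsums : ∑ m ∈ Finset.range n, s m = 2 * trapezoidInv y n := by
    rw [trapezoidInv, Finset.mul_sum]
    simp_rw [mul_div_cancel₀ _ (two_ne_zero' ℂ)]
    rw [Finset.sum_sub_distrib, Finset.sum_add_distrib, sub_eq_add_neg,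
      ← Finset.sum_neg_distrib]
    refine (add_comm _ _).trans ?_
    congr 1
    · rw [← Finset.sum_range_reflect]
      refine Finset.sum_congr rfl fun k hk ↦ ?_
      have : k + 1 ≤ n := Finset.mem_range.mp hk
      rw [show n - 1 - k = n - (k + 1) by omega, Nat.cast_sub this, ← div_neg]
      push_cast
      ring
    · exact Finset.sum_congr rfl fun k _ ↦ by ring
  rw [hsums] at key
  field_simp
  linear_combination key / 2

lemma mem_slitPlane_of_forall_ne {y : ℂ} (h : ∀ s : ℝ, 0 ≤ s → y + s ≠ 0) : y ∈ slitPlane := by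
  by_contra hy
  rw [Complex.mem_slitPlane_iff, not_or, not_lt, not_not] at hy
  refine h (-y.re) (by linarith [hy.1]) ?_
  apply Complex.ext <;> simp [hy.2]

lemma norm_log_add_sub_trapezoid_le {c : ℝ} (hc : 0 < c) {w : ℂ}
    (hw : ∀ s : ℝ, 0 ≤ s → c ≤ ‖w + s‖) {δ : ℝ} (hδ : 0 ≤ δ) :
    ‖log (w + δ) - log w - δ * ((1 / w + 1 / (w + δ)) / 2)‖ ≤ δ ^ 2 / c ^ 2 := by
  have hne : ∀ s : ℝ, 0 ≤ s → w + s ≠ 0 := fun s hs h ↦ by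
    have := hw s hs
    rw [h, norm_zero] at this
    linarith
  have hslit : ∀ s : ℝ, 0 ≤ s → w + s ∈ slitPlane := fun s hs ↦
    mem_slitPlane_of_forall_ne fun t ht ↦ by
      have := hne (s + t) (by positivity)
      rwa [Complex.ofReal_add, ← add_assoc] at this
  set a := (1 / w + 1 / (w + δ)) / 2 with ha
  have hder : ∀ t ∈ Set.Icc (0 : ℝ) δ, HasDerivWithinAt
      (fun t : ℝ ↦ log (w + t) - t * a) (1 / (w + t) - 1 * a) (Set.Icc 0 δ) t := by
    intro t ht
    have h1 : HasDerivAt (fun t : ℝ ↦ (t : ℂ)) 1 t := Complex.ofRealCLM.hasDerivAt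
    exact (((h1.const_add w).clog_real (hslit t ht.1)).sub (h1.mul_const a)).hasDerivWithinAt
  have hdiff : ∀ s t : ℝ, s ∈ Set.Icc 0 δ → t ∈ Set.Icc 0 δ →
      ‖1 / (w + t) - 1 / (w + s)‖ ≤ δ / c ^ 2 := by
    intro s t hs ht
    have h1 := hne s hs.1
    have h2 := hne t ht.1
    have h3 := hw s hs.1
    have h4 := hw t ht.1
    have h5 : |s - t| ≤ δ := abs_sub_le_iff.mpr ⟨by linarith [hs.2, ht.1], by linarith [ht.2, hs.1]⟩
    rw [div_sub_div _ _ h2 h1, show 1 * (w + s) - (w + t) * 1 = ((s - t : ℝ) : ℂ) by push_cast; ring,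
      norm_div, norm_mul, Complex.norm_real, Real.norm_eq_abs, sq]
    gcongr
  have hbound : ∀ t ∈ Set.Ico (0 : ℝ) δ, ‖1 / (w + t) - 1 * a‖ ≤ δ / c ^ 2 := by
    intro t ht
    have h1 := hdiff 0 t ⟨le_rfl, hδ⟩ ⟨ht.1, ht.2.le⟩
    have h2 := hdiff δ t ⟨hδ, le_rfl⟩ ⟨ht.1, ht.2.le⟩
    rw [Complex.ofReal_zero, add_zero] at h1
    rw [show 1 / (w + t) - 1 * a =
      ((1 / (w + t) - 1 / w) + (1 / (w + t) - 1 / (w + δ))) / 2 by rw [ha]; ring,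
      norm_div, Complex.norm_ofNat]
    linarith [norm_add_le (1 / (w + t) - 1 / w) (1 / (w + t) - 1 / (w + δ))]
  have := norm_image_sub_le_of_norm_deriv_le_segment' hder hbound δ ⟨hδ, le_rfl⟩
  simp only [Complex.ofReal_zero, add_zero, zero_mul, sub_zero] at this
  calc _ = ‖log (w + δ) - δ * a - log w‖ := by congr 1; ring
    _ ≤ δ / c ^ 2 * δ := this
    _ = _ := by ring

lemma norm_trapezoidInv_sub_log_le {c : ℝ} (hc : 0 < c) {y : ℂ}
    (hy : ∀ s : ℝ, 0 ≤ s → c ≤ ‖y + s‖) {n : ℕ} (hn : n ≠ 0) :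
    ‖trapezoidInv y n - (log (y + 1) - log y)‖ ≤ 1 / c ^ 2 * (1 / n) := by
  have hn0 : (n : ℂ) ≠ 0 := by exact_mod_cast hn
  have hn1 : (n : ℝ) ≠ 0 := by exact_mod_cast hn
  have htel : log (y + 1) - log y = ∑ k ∈ Finset.range n,
      (log (y + (k / n : ℝ) + (1 / n : ℝ)) - log (y + (k / n : ℝ))) := by
    have := Finset.sum_range_sub (fun k : ℕ ↦ log (y + (k / n : ℝ))) n
    rw [div_self hn1, Nat.cast_zero, zero_div, Complex.ofReal_zero, add_zero,
      Complex.ofReal_one] at this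
    rw [← this]
    refine Finset.sum_congr rfl fun k _ ↦ ?_
    congr 2
    push_cast
    ring
  rw [htel, trapezoidInv, ← Finset.sum_sub_distrib]
  calc _ ≤ ∑ k ∈ Finset.range n, (1 / n : ℝ) ^ 2 / c ^ 2 := by
        refine norm_sum_le_of_le _ fun k _ ↦ ?_
        have h := norm_log_add_sub_trapezoid_le hc (w := y + (k / n : ℝ)) (δ := 1 / n)
          (fun s hs ↦ by
            have := hy (k / n + s) (by positivity)
            rwa [Complex.ofReal_add, ← add_assoc] at this) (by positivity)
        rw [← norm_neg, neg_sub]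
        refine le_of_eq_of_le ?_ h
        congr 2
        have e1 : (n * y + k : ℂ) = n * (y + (k / n : ℝ)) := by push_cast; field_simp
        have e2 : (n * y + (k + 1) : ℂ) = n * (y + (k / n : ℝ) + (1 / n : ℝ)) := by
          push_cast; field_simp; ring
        rw [e1, e2, ← one_div_mul_one_div, ← one_div_mul_one_div]
        push_cast
        ring
    _ = _ := by
        rw [Finset.sum_const, Finset.card_range, nsmul_eq_mul]
        field_simp

lemma norm_trapezoidInv_le {c : ℝ} (hc : 0 < c) {y : ℂ}
    (hy : ∀ s : ℝ, 0 ≤ s → c ≤ ‖y + s‖) (n : ℕ) : ‖trapezoidInv y n‖ ≤ 1 / c := by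
  rcases eq_or_ne n 0 with rfl | hn
  · simp [trapezoidInv, hc.le]
  have hn0 : (n : ℂ) ≠ 0 := by exact_mod_cast hn
  have hn1 : (0 : ℝ) < n := by exact_mod_cast Nat.pos_of_ne_zero hn
  have key : ∀ x : ℝ, 0 ≤ x → ‖1 / (n * y + x)‖ ≤ 1 / (n * c) := by
    intro x hx
    have := hy (x / n) (by positivity)
    rw [show (n * y + x : ℂ) = n * (y + (x / n : ℝ)) by push_cast; field_simp, norm_div, norm_one,
      norm_mul, Complex.norm_natCast]
    gcongr
  calc _ ≤ ∑ k ∈ Finset.range n, 1 / (n * c) := by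
        refine norm_sum_le_of_le _ fun k _ ↦ ?_
        have h1 := key k (by positivity)
        have h2 := key (k + 1) (by positivity)
        push_cast at h1 h2
        rw [norm_div, Complex.norm_ofNat]
        linarith [norm_add_le (1 / (n * y + k)) (1 / (n * y + (k + 1)))]
    _ = _ := by
        rw [Finset.sum_const, Finset.card_range, nsmul_eq_mul]
        field_simp

lemma natCast_mul_add_ne_zero {y : ℂ} (hy : y ∈ slitPlane) {n : ℕ} (hn : n ≠ 0) {x : ℝ}
    (hx : 0 ≤ x) : n * y + x ≠ 0 := by
  obtain ⟨c, hc, H⟩ := exists_mul_le_norm_add hy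
  have hn0 : (n : ℂ) ≠ 0 := by exact_mod_cast hn
  have h := H y (Metric.mem_ball_self hc) (x / n) (by positivity)
  rw [show (n * y + x : ℂ) = n * (y + (x / n : ℝ)) by push_cast; field_simp]
  refine mul_ne_zero hn0 (norm_pos_iff.mp (lt_of_lt_of_le ?_ h))
  positivity

lemma differentiableAt_trapezoidInv {y : ℂ} (hy : y ∈ slitPlane) {n : ℕ} (hn : n ≠ 0) :
    DifferentiableAt ℂ (fun y ↦ trapezoidInv y n) y := by
  unfold trapezoidInv
  refine DifferentiableAt.fun_sum fun k _ ↦ ?_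
  have h1 := natCast_mul_add_ne_zero hy hn (x := k) (by positivity)
  have h2 := natCast_mul_add_ne_zero hy hn (x := k + 1) (by positivity)
  push_cast at h1 h2
  fun_prop (disch := assumption)

lemma differentiableOn_tsum_trapezoidInv :
    DifferentiableOn ℂ (fun y ↦ ∑' j : ℕ, (1 / ((3 * j + 4 : ℕ) : ℂ) * trapezoidInv y (3 * j + 4) -
      1 / ((3 * j + 2 : ℕ) : ℂ) * trapezoidInv y (3 * j + 2))) slitPlane := by
  intro y₀ hy₀
  obtain ⟨c, hc, H⟩ := exists_mul_le_norm_add hy₀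
  have H' : ∀ y ∈ Metric.ball y₀ c, ∀ s : ℝ, 0 ≤ s → c ≤ ‖y + s‖ := fun y hy s hs ↦
    le_trans (by nlinarith) (H y hy s hs)
  refine DifferentiableAt.differentiableWithinAt ?_
  refine DifferentiableOn.differentiableAt (s := Metric.ball y₀ c) ?_ (Metric.ball_mem_nhds _ hc)
  have hs : Summable fun j : ℕ ↦ (2 / c + 2 / c ^ 2) * (1 / ((j + 1 : ℕ) : ℝ) ^ 2) :=
    ((summable_nat_add_iff 1).mpr (Real.summable_one_div_nat_pow.mpr one_lt_two)).mul_left _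
  refine differentiableOn_tsum_of_summable_norm hs (fun j y hy ↦ ?_) Metric.isOpen_ball
    fun j y hy ↦ ?_
  · have hslit : y ∈ slitPlane := mem_slitPlane_of_forall_ne fun s hs h ↦ by
      have := H' y hy s hs
      rw [h, norm_zero] at this
      linarith
    exact (((differentiableAt_trapezoidInv hslit (by omega)).const_mul _).sub
      ((differentiableAt_trapezoidInv hslit (by omega)).const_mul _)).differentiableWithinAt
  · have h1 := norm_trapezoidInv_sub_log_le hc (H' y hy) (n := 3 * j + 4) (by omega)
    have h2 := norm_trapezoidInv_sub_log_le hc (H' y hy) (n := 3 * j + 2) (by omega)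
    have h3 := norm_trapezoidInv_le hc (H' y hy) (3 * j + 2)
    set p := trapezoidInv y (3 * j + 4)
    set q := trapezoidInv y (3 * j + 2)
    set l := log (y + 1) - log y
    have hj : (0 : ℝ) ≤ j := by positivity
    set b : ℝ := ((j + 1 : ℕ) : ℝ) with hb
    have hb' : b = j + 1 := by rw [hb]; push_cast; rfl
    have hb0 : 0 < b := by positivity
    have hp : (1 : ℝ) / ((3 * j + 4 : ℕ) : ℝ) ≤ 1 / b := by
      apply one_div_le_one_div_of_le hb0; push_cast; linarith
    have hq : (1 : ℝ) / ((3 * j + 2 : ℕ) : ℝ) ≤ 1 / b := by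
      apply one_div_le_one_div_of_le hb0; push_cast; linarith
    have hpq : ‖p - q‖ ≤ 2 / c ^ 2 * (1 / b) := by
      calc ‖p - q‖ = ‖(p - l) - (q - l)‖ := by congr 1; ring
        _ ≤ 1 / c ^ 2 * (1 / b) + 1 / c ^ 2 * (1 / b) :=
          (norm_sub_le _ _).trans (add_le_add (h1.trans (by gcongr)) (h2.trans (by gcongr)))
        _ = _ := by ring
    have hd : ‖(1 / ((3 * j + 4 : ℕ) : ℂ) - 1 / ((3 * j + 2 : ℕ) : ℂ))‖ ≤ 2 * (1 / b * (1 / b)) := by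
      have e1 : ((3 * j + 4 : ℕ) : ℂ) ≠ 0 := Nat.cast_ne_zero.mpr (by omega)
      have e2 : ((3 * j + 2 : ℕ) : ℂ) ≠ 0 := Nat.cast_ne_zero.mpr (by omega)
      have : (1 / ((3 * j + 4 : ℕ) : ℂ) - 1 / ((3 * j + 2 : ℕ) : ℂ)) =
          -2 * (1 / ((3 * j + 4 : ℕ) : ℂ) * (1 / ((3 * j + 2 : ℕ) : ℂ))) := by
        field_simp
        push_cast
        ring
      rw [this, norm_mul, norm_mul, norm_div, norm_div, Complex.norm_natCast, Complex.norm_natCast,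
        norm_one, norm_neg, Complex.norm_ofNat]
      gcongr
    calc _ = ‖1 / ((3 * j + 4 : ℕ) : ℂ) * (p - q) +
          (1 / ((3 * j + 4 : ℕ) : ℂ) - 1 / ((3 * j + 2 : ℕ) : ℂ)) * q‖ := by congr 1; ring
      _ ≤ 1 / b * (2 / c ^ 2 * (1 / b)) + 2 * (1 / b * (1 / b)) * (1 / c) := by
          refine (norm_add_le _ _).trans (add_le_add ?_ ?_)
          · rw [norm_mul, norm_div, Complex.norm_natCast, norm_one]
            gcongr
          · rw [norm_mul]
            gcongr
      _ = (2 / c + 2 / c ^ 2) * (1 / b ^ 2) := by field_simp; ring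

lemma finf_add_one (w : ℂ) : finf (w + 1) = finf w := by
  refine tsum_congr fun n ↦ ?_
  congr 1
  rw [mul_add, mul_one, Complex.exp_add,
    show (2 * π * I * (n + 1) : ℂ) = (n + 1 : ℕ) * (2 * π * I) by push_cast; ring,
    Complex.exp_nat_mul_two_pi_mul_I, mul_one]

/-- The Fricke image `f_∞*(y) = f_∞(−1/(3y))` is a holomorphic quantum modular function of
weight zero for `Γ₁(3)`: the cocycle of `γ₃ = [[1,0],[3,1]]` is trivial, and the cocycle
of `T = [[1,1],[0,1]]` extends holomorphically to the cut plane
`ℂ ∖ ℝ_{≤0} = Complex.slitPlane`. -/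
theorem stmt19 :
    (∀ y : ℂ, 0 < y.im → finf (-1 / (3 * (y / (3 * y + 1)))) = finf (-1 / (3 * y))) ∧
    ∃ h : ℂ → ℂ, DifferentiableOn ℂ h Complex.slitPlane ∧
      ∀ y : ℂ, 0 < y.im → h y = finf (-1 / (3 * (y + 1))) - finf (-1 / (3 * y)) := by
  refine ⟨fun y hy ↦ ?_, fun y ↦ 3 * (√3 : ℝ) / π * (1 / ((1 : ℕ) : ℂ) * trapezoidInv y 1 +
    ∑' j : ℕ, (1 / ((3 * j + 4 : ℕ) : ℂ) * trapezoidInv y (3 * j + 4) -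
      1 / ((3 * j + 2 : ℕ) : ℂ) * trapezoidInv y (3 * j + 2))), ?_, fun y hy ↦ ?_⟩
  · have h0 : y ≠ 0 := by rintro rfl; simp at hy
    have h1 : 3 * y + 1 ≠ 0 := by
      intro h
      have := congrArg Complex.im h
      simp [hy.ne'] at this
    rw [← finf_add_one]
    congr 1
    field_simp
    ring
  · refine DifferentiableOn.const_mul (DifferentiableOn.add (fun y hy ↦ ?_)
      differentiableOn_tsum_trapezoidInv) _
    exact ((differentiableAt_trapezoidInv hy one_ne_zero).const_mul _).differentiableWithinAt
  · have hy1 : 0 < (y + 1).im := by simpa using hy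
    beta_reduce
    rw [finf_fricke_eq hy, finf_fricke_eq hy1, ← mul_sub, add_sub_add_comm,
      ← (summable_cotFractionSum hy1.ne').tsum_sub (summable_cotFractionSum hy.ne'),
      cotFractionSum_add_one_sub hy one_ne_zero]
    congr 2
    refine tsum_congr fun j ↦ ?_
    rw [← cotFractionSum_add_one_sub hy (by omega), ← cotFractionSum_add_one_sub hy (by omega)]
    ring
end
end
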